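/- arXiv:2006.15747 — 2 statements merged into one kernel-verified Lean document; each statement's English description precedes it below -/
import Mathlib

section
/- Under 1-0 utilities (every u_{ij} ∈ {0,1}), any balanced fractional assignment that is leximin-optimal with respect to the uniform disagreement point is a Nash bargaining solution: let d_i = (1/n) Σ_j u_{ij}, and suppose x is a balanced fractional assignment with Σ_j u_{ij} x_{ij} ≥ d_i for all i whose vector of shifted utilities (Σ_j u_{ij} x_{ij} − d_i)_{i}, sorted in nondecreasing order, is lexicographically greatest among all balanced fractional assignments y with Σ_j u_{ij} y_{ij} ≥ d_i for all i. Then x maximizes ∏_i (Σ_j u_{ij} y_{ij} − d_i) over all balanced fractional assignments y with Σ_j u_{ij} y_{ij} ≥ d_i for all i. -/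
open Finset

/-- A fractional assignment: entries in `[0,1]`, each column sums to 1. -/
def IsFracAssign (n : ℕ) (x : Fin n → Fin n → ℝ) : Prop :=
  (∀ i j, 0 ≤ x i j ∧ x i j ≤ 1) ∧ ∀ j, ∑ i, x i j = 1

/-- A fractional assignment is balanced if each row sums to 1. -/
def IsBalanced (n : ℕ) (x : Fin n → Fin n → ℝ) : Prop :=
  ∀ i, ∑ j, x i j = 1

/-- An allocation: a vector in `[0,1]^n`. -/
def IsAlloc (n : ℕ) (y : Fin n → ℝ) : Prop :=
  ∀ j, 0 ≤ y j ∧ y j ≤ 1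

/-- A balanced allocation: an allocation whose entries sum to 1. -/
def IsBalancedAlloc (n : ℕ) (y : Fin n → ℝ) : Prop :=
  IsAlloc n y ∧ ∑ j, y j = 1

/-- Agent `i`'s utility for the allocation `y` under utility matrix `u`. -/
def util (n : ℕ) (u : Fin n → Fin n → ℝ) (i : Fin n) (y : Fin n → ℝ) : ℝ :=
  ∑ j, u i j * y j

/-- `x` is an HZ solution supported by the price vector `p`:
`x` is a balanced fractional assignment and, for every agent `i`,
(a) the row `x i` maximizes `i`'s utility over all balanced allocations within budget 1, and
(b) `x i` is a cheapest balanced allocation achieving at least that utility. -/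
def IsHZWithPrices (n : ℕ) (u x : Fin n → Fin n → ℝ) (p : Fin n → ℝ) : Prop :=
  IsFracAssign n x ∧ IsBalanced n x ∧ (∀ j, 0 ≤ p j) ∧
  ∀ i : Fin n,
    (∑ j, p j * x i j ≤ 1) ∧
    (∀ y, IsBalancedAlloc n y → ∑ j, p j * y j ≤ 1 → util n u i y ≤ util n u i (x i)) ∧
    (∀ y, IsBalancedAlloc n y → util n u i (x i) ≤ util n u i y →
      ∑ j, p j * x i j ≤ ∑ j, p j * y j)

/-- `x` is an HZ solution: some nonnegative price vector supports it. -/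
def IsHZ (n : ℕ) (u x : Fin n → Fin n → ℝ) : Prop :=
  ∃ p : Fin n → ℝ, IsHZWithPrices n u x p

/-- The vector `v` sorted in nondecreasing order. -/
noncomputable def sortedVec (n : ℕ) (v : Fin n → ℝ) : Fin n → ℝ :=
  v ∘ Tuple.sort v

theorem aux_lex (n : ℕ) (v w : Fin n → ℝ) (c : ℝ)
    (h : ∀ i, min (v i) c ≤ min (w i) c) (h0 : ∃ i, min (v i) c < min (w i) c) :
    ¬ toLex (sortedVec n w) ≤ toLex (sortedVec n v) := by
  intro hle
  have hsum : ∑ i, min (v i) c < ∑ i, min (w i) c := by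
    obtain ⟨i, hi⟩ := h0
    exact Finset.sum_lt_sum (fun i _ => h i) ⟨i, Finset.mem_univ _, hi⟩
  have mv : Monotone (sortedVec n v) := Tuple.monotone_sort v
  have mw : Monotone (sortedVec n w) := Tuple.monotone_sort w
  have key : ∀ j, min (sortedVec n v j) c = min (sortedVec n w j) c := by
    rcases hle.eq_or_lt with he | hlt
    · have he' : sortedVec n w = sortedVec n v := toLex.injective he
      intro j
      rw [he']
    · obtain ⟨k, hk1, hk2⟩ := hlt
      have hk1' : ∀ j, j < k → sortedVec n w j = sortedVec n v j := hk1
      have hk2' : sortedVec n w k < sortedVec n v k := hk2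
      have hq : c ≤ sortedVec n w k := by
        by_contra hq
        push Not at hq
        have hsub : ∀ i, w i ≤ sortedVec n w k → v i ≤ sortedVec n w k := by
          intro i hi
          have h1 := h i
          have h2 : min (w i) c ≤ sortedVec n w k := le_trans (min_le_left _ _) hi
          rcases min_le_iff.1 (h1.trans h2) with h3 | h3
          · exact h3
          · linarith
        have hsub' : ∀ i, i ≤ k → v (Tuple.sort w i) ≤ sortedVec n w k := fun i hi =>
          hsub _ (mw hi)
        -- the indices at least `k` in the order of `v` exclude these
        have hbig : ∀ i, k ≤ i → sortedVec n w k < v (Tuple.sort v i) := fun i hi =>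
          lt_of_lt_of_le hk2' (mv hi)
        have hc : (Finset.Iic k).card ≤ (Finset.Iio k).card := by
          apply Finset.card_le_card_of_injOn (fun i => (Tuple.sort v).symm (Tuple.sort w i))
          · intro i hi
            have hi' : i ≤ k := by simpa using hi
            have : (Tuple.sort v).symm (Tuple.sort w i) < k := by
              by_contra hcon
              push Not at hcon
              have h1 := hbig _ hcon
              rw [Equiv.apply_symm_apply] at h1
              exact absurd (hsub' i hi') (not_le.2 h1)
            simpa using this
          · intro a _ b _ hab
            simpa using hab
        simp at hc
      intro j
      rcases lt_or_ge j k with hj | hj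
      · rw [hk1' j hj]
      · have h1 := mv hj
        have h2 := mw hj
        rw [min_eq_right (by linarith), min_eq_right (by linarith)]
  have e1 : ∑ j, min (sortedVec n v j) c = ∑ i, min (v i) c :=
    Equiv.sum_comp (Tuple.sort v) (fun i => min (v i) c)
  have e2 : ∑ j, min (sortedVec n w j) c = ∑ i, min (w i) c :=
    Equiv.sum_comp (Tuple.sort w) (fun i => min (w i) c)
  have e3 : ∑ j, min (sortedVec n v j) c = ∑ j, min (sortedVec n w j) c :=
    Finset.sum_congr rfl (fun j _ => key j)
  linarith

theorem aux_abel {ι : Type*} [DecidableEq ι] (v δ : ι → ℝ) (hv : ∀ i, 0 < v i) (s : Finset ι) :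
    (∀ t, ∑ i ∈ s.filter (fun i => v i < t), δ i ≤ 0) →
    ∀ M, 0 < M → (∀ i ∈ s, v i ≤ M) → ∑ i ∈ s, δ i / v i ≤ (∑ i ∈ s, δ i) / M := by
  induction s using Finset.strongInduction with
  | H s ih =>
    intro h M hM hsM
    rcases s.eq_empty_or_nonempty with rfl | hne
    · simp
    obtain ⟨a, ha, hmax⟩ := s.exists_max_image v hne
    have hss : s.filter (fun i => v i < v a) ⊂ s := by
      rw [Finset.filter_ssubset]
      exact ⟨a, ha, lt_irrefl _⟩
    have h1 := ih _ hss (by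
      intro t
      have := h (min t (v a))
      rw [Finset.filter_filter]
      have e : s.filter (fun i => v i < v a ∧ v i < t) = s.filter (fun i => v i < min t (v a)) := by
        apply Finset.filter_congr
        intro i _
        rw [lt_min_iff]
        tauto
      rw [e]
      exact this) (v a) (hv a) (by
        intro i hi
        exact (Finset.mem_filter.1 hi).2.le)
    have hs0 : ∑ i ∈ s, δ i ≤ 0 := by
      have := h (M + 1)
      rwa [Finset.filter_true_of_mem (fun i hi => by linarith [hsM i hi])] at this
    have h2 : ∑ i ∈ s.filter (fun i => ¬ v i < v a), δ i / v i
        = (∑ i ∈ s.filter (fun i => ¬ v i < v a), δ i) / v a := by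
      rw [Finset.sum_div]
      apply Finset.sum_congr rfl
      intro i hi
      have hi' := Finset.mem_filter.1 hi
      rw [le_antisymm (hmax i hi'.1) (not_lt.1 hi'.2)]
    have h3 := Finset.sum_filter_add_sum_filter_not s (fun i => v i < v a) (fun i => δ i / v i)
    have h4 := Finset.sum_filter_add_sum_filter_not s (fun i => v i < v a) (fun i => δ i)
    rw [← h3, h2]
    calc _ ≤ (∑ i ∈ s.filter (fun i => v i < v a), δ i) / v a
          + (∑ i ∈ s.filter (fun i => ¬ v i < v a), δ i) / v a := by linarith
      _ = (∑ i ∈ s, δ i) / v a := by rw [← add_div, h4]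
      _ ≤ (∑ i ∈ s, δ i) / M := by
        rw [div_le_div_iff₀ (hv a) hM]
        exact mul_le_mul_of_nonpos_left (hsM a ha) hs0

theorem aux_prod {ι : Type*} [Fintype ι] (v w : ι → ℝ) (hv : ∀ i, 0 < v i) (hw : ∀ i, 0 ≤ w i)
    (h : ∑ i, (w i - v i) / v i ≤ 0) : ∏ i, w i ≤ ∏ i, v i := by
  have h1 : ∏ i, (w i / v i) ≤ ∏ i, Real.exp ((w i - v i) / v i) := by
    apply Finset.prod_le_prod
    · intro i _
      exact div_nonneg (hw i) (hv i).le
    · intro i _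
      have := Real.add_one_le_exp ((w i - v i) / v i)
      have e : (w i - v i) / v i + 1 = w i / v i := by
        have := (hv i).ne'
        field_simp
        ring
      linarith
  rw [← Real.exp_sum, Finset.prod_div_distrib] at h1
  have h2 : Real.exp (∑ i, (w i - v i) / v i) ≤ 1 := Real.exp_le_one_iff.2 h
  have h3 : 0 < ∏ i, v i := Finset.prod_pos (fun i _ => hv i)
  exact (div_le_one h3).1 (h1.trans h2)

theorem aux_complete (n : ℕ) (z : Fin n → Fin n → ℝ) (h0 : ∀ i j, 0 ≤ z i j)
    (hr : ∀ i, ∑ j, z i j ≤ 1) (hc : ∀ j, ∑ i, z i j ≤ 1) :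
    ∃ z' : Fin n → Fin n → ℝ, IsFracAssign n z' ∧ IsBalanced n z' ∧ ∀ i j, z i j ≤ z' i j := by
  set a : Fin n → ℝ := fun i => 1 - ∑ j, z i j with ha
  set b : Fin n → ℝ := fun j => 1 - ∑ i, z i j with hb
  have ha0 : ∀ i, 0 ≤ a i := fun i => by simp only [ha]; linarith [hr i]
  have hb0 : ∀ i, 0 ≤ b i := fun i => by simp only [hb]; linarith [hc i]
  have hab : ∑ i, a i = ∑ j, b j := by
    simp only [ha, hb, Finset.sum_sub_distrib]
    rw [Finset.sum_comm]
  set D := ∑ i, a i with hD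
  have hD0 : 0 ≤ D := Finset.sum_nonneg (fun i _ => ha0 i)
  have hle : ∀ i j, z i j ≤ z i j + a i * b j / D := fun i j => by
    have : 0 ≤ a i * b j / D := div_nonneg (mul_nonneg (ha0 i) (hb0 j)) hD0
    linarith
  have hrow : ∀ i, ∑ j, (z i j + a i * b j / D) = 1 := by
    intro i
    rw [Finset.sum_add_distrib, ← Finset.sum_div, ← Finset.mul_sum, ← hab]
    have : a i * D / D = a i := by
      rcases eq_or_ne D 0 with h | h
      · have := (Finset.sum_eq_zero_iff_of_nonneg (fun i _ => ha0 i)).1 (hD ▸ h) i (Finset.mem_univ _)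
        rw [this]; simp
      · field_simp
    rw [this]
    simp [ha]
  have hcol : ∀ j, ∑ i, (z i j + a i * b j / D) = 1 := by
    intro j
    rw [Finset.sum_add_distrib, ← Finset.sum_div, ← Finset.sum_mul, ← hD]
    have : D * b j / D = b j := by
      rcases eq_or_ne D 0 with h | h
      · have := (Finset.sum_eq_zero_iff_of_nonneg (fun i _ => hb0 i)).1 (hab ▸ h) j (Finset.mem_univ _)
        rw [this]; simp
      · field_simp
    rw [this]
    simp [hb]
  refine ⟨fun i j => z i j + a i * b j / D, ⟨fun i j => ⟨(h0 i j).trans (hle i j), ?_⟩, hcol⟩,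
    hrow, hle⟩
  rw [← hrow i]
  exact Finset.single_le_sum (f := fun j => z i j + a i * b j / D)
    (fun j _ => (h0 i j).trans (hle i j)) (Finset.mem_univ j)

theorem aux_improve (n : ℕ) (u : Fin n → Fin n → ℝ) (hbin : ∀ i j, u i j = 0 ∨ u i j = 1)
    (x y : Fin n → Fin n → ℝ) (hx : IsFracAssign n x) (hxb : IsBalanced n x)
    (hy : IsFracAssign n y) (hyb : IsBalanced n y) (S : Finset (Fin n))
    (hlt : ∑ i ∈ S, util n u i (x i) < ∑ i ∈ S, util n u i (y i)) :
    ∃ z, IsFracAssign n z ∧ IsBalanced n z ∧ (∀ i ∈ S, util n u i (x i) ≤ util n u i (z i)) ∧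
      ∃ i ∈ S, util n u i (x i) < util n u i (z i) := by
  classical
  by_contra hno
  set f : Fin n → ℝ := fun i => if i ∈ S then util n u i (x i) else 0 with hf
  have hu0 : ∀ i j, 0 ≤ u i j := fun i j => by rcases hbin i j with h | h <;> rw [h]; norm_num
  have hu1 : ∀ i j, u i j ≤ 1 := fun i j => by rcases hbin i j with h | h <;> rw [h]; norm_num
  have hux : ∀ i, util n u i (x i) ≤ 1 := by
    intro i
    rw [← hxb i]
    apply Finset.sum_le_sum
    intro j _
    nlinarith [hu1 i j, (hx.1 i j).1]
  have hf1 : ∀ i, f i ≤ 1 := by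
    intro i
    simp only [hf]
    split_ifs
    · exact hux i
    · norm_num
  let Sub : (Fin n → Fin n → ℝ) → Prop := fun z =>
    (∀ i j, 0 ≤ z i j) ∧ (∀ i j, z i j ≠ 0 → i ∈ S ∧ u i j = 1) ∧
    (∀ i, ∑ j, z i j = f i) ∧ (∀ j, ∑ i, z i j ≤ 1)
  let F : (Fin n → Fin n → ℝ) → Finset (Fin n) := fun z =>
    Finset.univ.filter (fun j => ∑ i, z i j < 1)
  have hex : ∃ k, ∃ z, Sub z ∧ n - (F z).card = k := by
    refine ⟨_, fun i j => if i ∈ S then u i j * x i j else 0, ⟨?_, ?_, ?_, ?_⟩, rfl⟩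
    · intro i j
      dsimp only
      split_ifs
      · exact mul_nonneg (hu0 i j) (hx.1 i j).1
      · exact le_rfl
    · intro i j hij
      dsimp only at hij
      split_ifs at hij with hi
      · refine ⟨hi, ?_⟩
        rcases hbin i j with h | h
        · simp [h] at hij
        · exact h
      · exact absurd rfl hij
    · intro i
      simp only [hf]
      split_ifs
      · rfl
      · simp
    · intro j
      rw [← hx.2 j]
      apply Finset.sum_le_sum
      intro i _
      dsimp only
      split_ifs
      · nlinarith [hu1 i j, (hx.1 i j).1]
      · exact (hx.1 i j).1
  obtain ⟨z, ⟨hz0, hzs, hzr, hzc⟩, hzk⟩ := Nat.find_spec hex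
  have hzmax : ∀ z', Sub z' → (F z').card ≤ (F z).card := by
    intro z' hz'
    have h1 := Nat.find_min' hex ⟨z', hz', rfl⟩
    have h2 : (F z').card ≤ n := by simpa using Finset.card_le_univ (F z')
    omega
  -- deficient agents see no free item
  have fact1 : ∀ i ∈ S, ∀ j, u i j = 1 → ∑ k, z k j < 1 → f i = 1 := by
    intro i hi j hij hj
    by_contra hne
    have hfi : f i < 1 := lt_of_le_of_ne (hf1 i) hne
    obtain ⟨ε, hε0, hε⟩ : ∃ ε, 0 < ε ∧ ε ≤ 1 - f i ∧ ε ≤ 1 - ∑ k, z k j :=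
      ⟨min (1 - f i) (1 - ∑ k, z k j), lt_min (by linarith) (by linarith),
        min_le_left _ _, min_le_right _ _⟩
    let e : Fin n → Fin n → ℝ := fun a b => if a = i then (if b = j then ε else 0) else 0
    have er : ∀ a, ∑ b, e a b = if a = i then ε else 0 := by
      intro a
      by_cases h : a = i <;> simp [e, h]
    have ec : ∀ b, ∑ a, e a b = if b = j then ε else 0 := by
      intro b
      simp [e]
    have e0 : ∀ a b, 0 ≤ e a b := by
      intro a b
      simp only [e]
      split_ifs <;> linarith
    obtain ⟨z', hz'1, hz'2, hz'3⟩ := aux_complete n (fun a b => z a b + e a b)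
      (fun a b => add_nonneg (hz0 a b) (e0 a b))
      (by
        intro a
        rw [Finset.sum_add_distrib, er, hzr]
        split_ifs with h
        · subst h; linarith
        · linarith [hf1 a])
      (by
        intro b
        rw [Finset.sum_add_distrib, ec]
        split_ifs with h
        · subst h; linarith
        · linarith [hzc b])
    have hut : ∀ a ∈ S, util n u a (x a) + (if a = i then ε else 0) ≤ util n u a (z' a) := by
      intro a ha
      have h1 : util n u a (x a) = ∑ b, z a b := by rw [hzr]; simp [hf, ha]
      rw [h1, ← er, ← Finset.sum_add_distrib]
      apply Finset.sum_le_sum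
      intro b _
      have h2 := hz'3 a b
      rcases hbin a b with h | h
      · have h3 : z a b = 0 := by
          by_contra hcon
          have := (hzs a b hcon).2
          linarith
        have h4 : e a b = 0 := by
          simp only [e]
          split_ifs with h5 h6
          · subst h5; subst h6; linarith
          · rfl
          · rfl
        rw [h, h3, h4]; simp
      · rw [h]; linarith
    apply hno
    refine ⟨z', hz'1, hz'2, ?_, i, hi, ?_⟩
    · intro a ha
      have := hut a ha
      split_ifs at this <;> linarith
    · have := hut i hi
      simp only [if_true] at this
      linarith
  have fact2 : ∀ k j j', z k j ≠ 0 → ¬ ∑ i, z i j < 1 → u k j' = 1 → ¬ ∑ i, z i j' < 1 := by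
    intro k j j' hkj hj hkj' hj'
    have hkS := (hzs k j hkj).1
    have hzpos : 0 < z k j := lt_of_le_of_ne (hz0 k j) (Ne.symm hkj)
    have hne : j ≠ j' := by
      rintro rfl
      exact hj hj'
    obtain ⟨ε, hε0, hε1, hε2⟩ : ∃ ε, 0 < ε ∧ ε ≤ z k j ∧ ε < 1 - ∑ i, z i j' := by
      refine ⟨min (z k j) ((1 - ∑ i, z i j') / 2), lt_min hzpos (by linarith), min_le_left _ _, ?_⟩
      have := min_le_right (z k j) ((1 - ∑ i, z i j') / 2)
      linarith
    let e : Fin n → Fin n → ℝ := fun a b =>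
      if a = k then ((if b = j' then ε else 0) - (if b = j then ε else 0)) else 0
    have er : ∀ a, ∑ b, e a b = 0 := by
      intro a
      by_cases h : a = k <;> simp [e, h]
    have ec : ∀ b, ∑ a, e a b = (if b = j' then ε else 0) - (if b = j then ε else 0) := by
      intro b
      simp [e]
    have hcs : ∀ b, ∑ a, (z a b + e a b) =
        ∑ a, z a b + ((if b = j' then ε else 0) - (if b = j then ε else 0)) := by
      intro b
      rw [Finset.sum_add_distrib, ec]
    have hsub : Sub (fun a b => z a b + e a b) := by
      refine ⟨?_, ?_, ?_, ?_⟩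
      · intro a b
        have := hz0 a b
        simp only [e]
        split_ifs with h1 h2 h3 h3
        · linarith
        · linarith
        · subst h1; subst h3; linarith
        · linarith
        · linarith
      · intro a b hab
        by_cases h : z a b = 0
        · have h2 : e a b ≠ 0 := by
            intro h3
            apply hab
            simp [h, h3]
          have h3 : a = k := by
            by_contra h4
            apply h2
            simp [e, h4]
          subst h3
          refine ⟨hkS, ?_⟩
          by_cases h5 : b = j'
          · rw [h5]; exact hkj'
          · by_cases h6 : b = j
            · rw [h6] at h; exact absurd h hkj
            · exfalso
              apply h2
              simp [e, h5, h6]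
        · exact hzs a b h
      · intro a
        dsimp only
        rw [Finset.sum_add_distrib, er, hzr, add_zero]
      · intro b
        dsimp only
        rw [hcs]
        have := hzc b
        split_ifs with h1 h2 h2
        · linarith
        · subst h1; linarith
        · linarith
        · linarith
    have hss : F z ⊂ F (fun a b => z a b + e a b) := by
      rw [Finset.ssubset_iff_of_subset]
      · refine ⟨j, ?_, ?_⟩
        · simp only [F, Finset.mem_filter, Finset.mem_univ, true_and]
          rw [hcs]
          have := hzc j
          simp only [hne, if_false, if_true]
          linarith
        · simp only [F, Finset.mem_filter, Finset.mem_univ, true_and]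
          exact hj
      · intro b hb
        simp only [F, Finset.mem_filter, Finset.mem_univ, true_and] at hb ⊢
        rw [hcs]
        split_ifs with h1 h2 h2
        · linarith
        · subst h1; linarith
        · linarith
        · linarith
    exact absurd (hzmax _ hsub) (not_le.2 (Finset.card_lt_card hss))
  -- dual certificate
  let p : Fin n → ℝ := fun j => if ∑ i, z i j < 1 then 0 else 1
  let q : Fin n → ℝ := fun i => if i ∈ S ∧ ∃ j, u i j = 1 ∧ ∑ k, z k j < 1 then 1 else 0
  have hp0 : ∀ j, 0 ≤ p j := fun j => by simp only [p]; split_ifs <;> norm_num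
  have hq0 : ∀ i, 0 ≤ q i := fun i => by simp only [q]; split_ifs <;> norm_num
  have hpq : ∀ i ∈ S, ∀ j, u i j ≤ p j + q i := by
    intro i hi j
    rcases hbin i j with h | h
    · rw [h]; exact add_nonneg (hp0 j) (hq0 i)
    · rw [h]
      by_cases hj : ∑ k, z k j < 1
      · have : q i = 1 := if_pos ⟨hi, j, h, hj⟩
        linarith [hp0 j]
      · have : p j = 1 := if_neg hj
        linarith [hq0 i]
  have hdbl : ∀ m : Fin n → Fin n → ℝ, ∑ i, ∑ j, (p j + q i) * m i j =
      ∑ j, p j * ∑ i, m i j + ∑ i, q i * ∑ j, m i j := by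
    intro m
    simp only [add_mul, Finset.sum_add_distrib, Finset.mul_sum]
    rw [Finset.sum_comm]
  have hY : ∑ i ∈ S, util n u i (y i) ≤ ∑ j, p j + ∑ i, q i := by
    calc ∑ i ∈ S, util n u i (y i) ≤ ∑ i ∈ S, ∑ j, (p j + q i) * y i j := by
          apply Finset.sum_le_sum
          intro i hi
          apply Finset.sum_le_sum
          intro j _
          exact mul_le_mul_of_nonneg_right (hpq i hi j) (hy.1 i j).1
      _ ≤ ∑ i, ∑ j, (p j + q i) * y i j := by
          apply Finset.sum_le_sum_of_subset_of_nonneg (Finset.subset_univ _)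
          intro i _ _
          apply Finset.sum_nonneg
          intro j _
          exact mul_nonneg (add_nonneg (hp0 j) (hq0 i)) (hy.1 i j).1
      _ = ∑ j, p j + ∑ i, q i := by
          rw [hdbl]
          simp only [hy.2, hyb _, mul_one]
  have hX : ∑ i ∈ S, util n u i (x i) = ∑ j, p j + ∑ i, q i := by
    have h1 : ∑ i ∈ S, util n u i (x i) = ∑ i, ∑ j, z i j := by
      simp only [hzr, hf]
      simp
    have h2 : ∑ i, ∑ j, z i j = ∑ i, ∑ j, (p j + q i) * z i j := by
      apply Finset.sum_congr rfl
      intro i _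
      apply Finset.sum_congr rfl
      intro j _
      by_cases hz : z i j = 0
      · simp [hz]
      · obtain ⟨hiS, hu⟩ := hzs i j hz
        have : p j + q i = 1 := by
          by_cases hj : ∑ k, z k j < 1
          · have h3 : q i = 1 := if_pos ⟨hiS, j, hu, hj⟩
            have h4 : p j = 0 := if_pos hj
            rw [h3, h4]; norm_num
          · have h4 : p j = 1 := if_neg hj
            have h3 : q i = 0 := by
              apply if_neg
              rintro ⟨_, j', hj', hj''⟩
              exact fact2 i j j' hz hj hj' hj''
            rw [h3, h4]; norm_num
        rw [this, one_mul]
    rw [h1, h2, hdbl]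
    congr 1
    · apply Finset.sum_congr rfl
      intro j _
      by_cases hj : ∑ k, z k j < 1
      · have h4 : p j = 0 := if_pos hj
        simp [h4]
      · rw [le_antisymm (hzc j) (not_lt.1 hj), mul_one]
    · apply Finset.sum_congr rfl
      intro i _
      by_cases hi : i ∈ S ∧ ∃ j, u i j = 1 ∧ ∑ k, z k j < 1
      · obtain ⟨hiS, j, hj, hj'⟩ := hi
        rw [hzr, fact1 i hiS j hj hj', mul_one]
      · have : q i = 0 := if_neg hi
        simp [this]
  linarith

theorem aux_util_bounds (n : ℕ) (u : Fin n → Fin n → ℝ) (hbin : ∀ i j, u i j = 0 ∨ u i j = 1)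
    (x : Fin n → Fin n → ℝ) (hx : IsFracAssign n x) (hxb : IsBalanced n x) (i : Fin n) :
    0 ≤ util n u i (x i) ∧ util n u i (x i) ≤ 1 := by
  constructor
  · apply Finset.sum_nonneg
    intro j _
    have := (hx.1 i j).1
    rcases hbin i j with h | h <;> rw [h] <;> linarith
  · rw [← hxb i]
    apply Finset.sum_le_sum
    intro j _
    have := (hx.1 i j).1
    rcases hbin i j with h | h <;> rw [h] <;> linarith

/-- Under 1-0 utilities, any balanced fractional assignment that is
leximin-optimal with respect to the uniform disagreement point (among balanced
fractional assignments giving each agent at least her disagreement utility) is a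
Nash bargaining solution. -/
theorem nb_of_leximin_shifted_of_binary (n : ℕ) (u : Fin n → Fin n → ℝ)
    (hbin : ∀ i j, u i j = 0 ∨ u i j = 1)
    (hrow : ∀ i, ∃ j, 0 < u i j) (hcol : ∀ j, ∃ i, 0 < u i j)
    (d : Fin n → ℝ) (hd : ∀ i, d i = (1 / (n : ℝ)) * ∑ j, u i j)
    (x : Fin n → Fin n → ℝ)
    (hx : IsFracAssign n x ∧ IsBalanced n x ∧ ∀ i, d i ≤ util n u i (x i))
    (hlex : ∀ y, IsFracAssign n y → IsBalanced n y → (∀ i, d i ≤ util n u i (y i)) →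
      toLex (sortedVec n (fun i => util n u i (y i) - d i)) ≤
        toLex (sortedVec n (fun i => util n u i (x i) - d i))) :
    ∀ y, IsFracAssign n y → IsBalanced n y → (∀ i, d i ≤ util n u i (y i)) →
      ∏ i, (util n u i (y i) - d i) ≤ ∏ i, (util n u i (x i) - d i) := by
  obtain ⟨hxa, hxb, hxd⟩ := hx
  intro y hya hyb hyd
  set v : Fin n → ℝ := fun i => util n u i (x i) - d i with hv
  have hv0 : ∀ i, 0 ≤ v i := fun i => by simp only [hv]; linarith [hxd i]
  have hw0 : ∀ i, 0 ≤ util n u i (y i) - d i := fun i => by linarith [hyd i]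
  by_cases hpos : ∀ i, 0 < v i
  · apply aux_prod v _ hpos hw0
    have key : ∀ t, ∑ i ∈ Finset.univ.filter (fun i => v i < t),
        (util n u i (y i) - d i - v i) ≤ 0 := by
      intro t
      by_contra hcon
      push Not at hcon
      obtain ⟨z, hza, hzb, hz1, i0, hi0, hz2⟩ := aux_improve n u hbin x y hxa hxb hya hyb
        (Finset.univ.filter (fun i => v i < t)) (by
          rw [← sub_pos, ← Finset.sum_sub_distrib]
          refine lt_of_lt_of_eq hcon (Finset.sum_congr rfl (fun i _ => ?_))
          simp only [hv]; ring)
      simp only [Finset.mem_filter, Finset.mem_univ, true_and] at hz1 hi0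
      obtain ⟨η, hη0, hη1, hη⟩ : ∃ η : ℝ, 0 < η ∧ η < 1 ∧ ∀ i, v i < t → v i < t - η := by
        have h1 : ∀ᶠ η : ℝ in nhdsWithin 0 (Set.Ioi 0), ∀ i, v i < t → v i < t - η := by
          rw [Filter.eventually_all]
          intro i
          by_cases hi : v i < t
          · filter_upwards [Ioo_mem_nhdsGT (sub_pos.2 hi)] with η hη _
            linarith [hη.2]
          · exact Filter.Eventually.of_forall (fun _ h => absurd h hi)
        obtain ⟨η, h2, h3⟩ := (h1.and (Ioo_mem_nhdsGT (zero_lt_one (α := ℝ)))).exists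
        exact ⟨η, h3.1, h3.2, h2⟩
      let m : Fin n → Fin n → ℝ := fun i j => (1 - η) * x i j + η * z i j
      have hmu : ∀ i, util n u i (m i) = (1 - η) * util n u i (x i) + η * util n u i (z i) := by
        intro i
        simp only [util, m, Finset.mul_sum, ← Finset.sum_add_distrib]
        exact Finset.sum_congr rfl (fun j _ => by ring)
      have hma : IsFracAssign n m := by
        refine ⟨fun i j => ?_, fun j => ?_⟩
        · have h1 := hxa.1 i j
          have h2 := hza.1 i j
          simp only [m]
          constructor
          · have := mul_nonneg (sub_nonneg.2 hη1.le) h1.1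
            have := mul_nonneg hη0.le h2.1
            linarith
          · nlinarith
        · simp only [m, Finset.sum_add_distrib, ← Finset.mul_sum, hxa.2, hza.2]
          ring
      have hmb : IsBalanced n m := by
        intro i
        simp only [m, Finset.sum_add_distrib, ← Finset.mul_sum, hxb i, hzb i]
        ring
      have hin : ∀ i, v i < t → v i ≤ util n u i (m i) - d i := by
        intro i hi
        rw [hmu]
        simp only [hv]
        nlinarith [hz1 i hi]
      have hout : ∀ i, ¬ v i < t → t - η ≤ util n u i (m i) - d i := by
        intro i hi
        rw [hmu]
        simp only [hv, not_lt] at hi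
        have h1 := aux_util_bounds n u hbin x hxa hxb i
        have h2 := aux_util_bounds n u hbin z hza hzb i
        nlinarith
      have hmd : ∀ i, d i ≤ util n u i (m i) := by
        intro i
        by_cases hi : v i < t
        · linarith [hin i hi, hv0 i]
        · linarith [hout i hi, hη i0 hi0, hv0 i0]
      refine aux_lex n v (fun i => util n u i (m i) - d i) (t - η) ?_ ⟨i0, ?_⟩
        (hlex m hma hmb hmd)
      · intro i
        by_cases hi : v i < t
        · exact min_le_min_right _ (hin i hi)
        · rw [min_eq_right (hout i hi)]
          exact min_le_right _ _
      · have h1 := hη i0 hi0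
        rw [min_eq_left h1.le, lt_min_iff]
        refine ⟨?_, h1⟩
        rw [hmu]
        simp only [hv]
        nlinarith
    have h1 := aux_abel v (fun i => util n u i (y i) - d i - v i) hpos Finset.univ key
      (∑ i, v i + 1) (by linarith [Finset.sum_nonneg (fun i (_ : i ∈ Finset.univ) => hv0 i)])
      (fun i _ => by
        have := Finset.single_le_sum (f := v) (fun i _ => hv0 i) (Finset.mem_univ i)
        linarith)
    have h2 : ∑ i, (util n u i (y i) - d i - v i) ≤ 0 := by
      have := key (∑ i, v i + 1)
      rwa [Finset.filter_true_of_mem (fun i _ => by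
        have := Finset.single_le_sum (f := v) (fun i _ => hv0 i) (Finset.mem_univ i)
        linarith)] at this
    refine h1.trans (div_nonpos_of_nonpos_of_nonneg h2 ?_)
    linarith [Finset.sum_nonneg (fun i (_ : i ∈ Finset.univ) => hv0 i)]
  · push Not at hpos
    obtain ⟨i0, hi0⟩ := hpos
    have hvi0 : v i0 = 0 := le_antisymm hi0 (hv0 i0)
    rw [Finset.prod_eq_zero (f := v) (Finset.mem_univ i0) hvi0]
    by_contra hcon
    push Not at hcon
    have hwpos : ∀ i, 0 < util n u i (y i) - d i := by
      intro i
      refine lt_of_le_of_ne (hw0 i) (fun h => ?_)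
      rw [Finset.prod_eq_zero (Finset.mem_univ i) h.symm] at hcon
      exact lt_irrefl _ hcon
    obtain ⟨k, _, hk⟩ := Finset.exists_min_image Finset.univ
      (fun i => util n u i (y i) - d i) ⟨i0, Finset.mem_univ _⟩
    refine aux_lex n v (fun i => util n u i (y i) - d i) (util n u k (y k) - d k) ?_ ⟨i0, ?_⟩
      (hlex y hya hyb hyd)
    · intro i
      rw [min_eq_right (hk i (Finset.mem_univ i))]
      exact min_le_right _ _
    · rw [min_eq_right (hk i0 (Finset.mem_univ i0)), hvi0]
      exact lt_of_le_of_lt (min_le_left _ _) (hwpos k)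
end

section
/- The HZ solution need not be Pareto optimal among the set of all (not necessarily balanced) fractional assignments: there exist an assignment problem with bi-valued utilities u, an HZ solution x of it, and a fractional assignment y such that Σ_j u_{ij} y_{ij} ≥ Σ_j u_{ij} x_{ij} for every agent i, with strict inequality for at least one agent. -/
open Finset

/-- Utilities `u` are bi-valued with values `α i > β i ≥ 0` for each agent `i`. -/
def BiValued (n : ℕ) (u : Fin n → Fin n → ℝ) (α β : Fin n → ℝ) : Prop :=
  ∀ i, 0 ≤ β i ∧ β i < α i ∧ ∀ j, u i j = α i ∨ u i j = β i

/-- The HZ solution need not be Pareto optimal among all (not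
necessarily balanced) fractional assignments: some HZ solution of some bi-valued
instance is Pareto dominated by a fractional assignment. -/
theorem hz_not_pareto_optimal_unbalanced :
    ∃ (n : ℕ) (u : Fin n → Fin n → ℝ) (α β : Fin n → ℝ) (x y : Fin n → Fin n → ℝ),
      BiValued n u α β ∧
      (∀ i, ∃ j, 0 < u i j) ∧ (∀ j, ∃ i, 0 < u i j) ∧
      IsHZ n u x ∧ IsFracAssign n y ∧
      (∀ i, util n u i (x i) ≤ util n u i (y i)) ∧
      (∃ i, util n u i (x i) < util n u i (y i)) := by
  -- Agent 0 values the items (10, 1), agent 1 values them (2, 1); the even split with prices (2, 0)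
  -- is an HZ solution, and trading across row sums improves both agents.
  refine ⟨2, ![![10, 1], ![2, 1]], ![10, 2], ![1, 1], ![![1/2, 1/2], ![1/2, 1/2]],
    ![![3/5, 0], ![2/5, 1]], ?_, ?_, ?_, ⟨![2, 0], ?_, ?_, ?_, ?_⟩, ?_, ?_, ?_⟩
  · intro i
    fin_cases i <;> norm_num [Fin.forall_fin_two]
  · intro i
    refine ⟨0, ?_⟩
    fin_cases i <;> norm_num
  · intro j
    refine ⟨0, ?_⟩
    fin_cases j <;> norm_num
  · norm_num [IsFracAssign, Fin.forall_fin_two, Fin.sum_univ_two]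
  · norm_num [IsBalanced, Fin.forall_fin_two, Fin.sum_univ_two]
  · norm_num [Fin.forall_fin_two]
  · intro i
    refine ⟨?_, ?_, ?_⟩
    · fin_cases i <;> norm_num [Fin.sum_univ_two]
    · rintro y ⟨-, hy⟩ h
      simp only [Fin.sum_univ_two] at hy h
      fin_cases i <;> simp [util, Fin.sum_univ_two] at h ⊢ <;> linarith
    · rintro y ⟨-, hy⟩ h
      simp only [util, Fin.sum_univ_two] at hy h
      fin_cases i <;> simp [Fin.sum_univ_two] at h ⊢ <;> linarith
  · norm_num [IsFracAssign, Fin.forall_fin_two, Fin.sum_univ_two]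
  · norm_num [util, Fin.forall_fin_two, Fin.sum_univ_two]
  · refine ⟨1, ?_⟩
    norm_num [util, Fin.sum_univ_two]
end
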